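/- Let α1, α2 ∈ K and set u = a−b, v = b−c, w = c−a in D_3(α1,α2). Then u·a = −b·u, u·b = −a·u, u·c = (c−a−b)·u, u·v = v·u, u·w = w·u, v·w = w·v, u·v + v·w + u·w = (α2−3α1)·1, u³ = (3α1−α2)·u, u²·v + u·v² = 0, and u·v·w = 0. -/

import Mathlib

noncomputable section

open FreeAlgebra

/-- The defining relations of the PBW deformation `D₃(α₁, α₂)` of the Fomin–Kirillov
algebra `E₃`: with generators `a = ι K 0`, `b = ι K 1`, `c = ι K 2`, the relations are
`a² = b² = c² = α₁`, `ca + bc + ab = α₂` and `cb + ba + ac = α₂`. -/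
inductive D3Rel (K : Type) [Field K] (α1 α2 : K) :
    FreeAlgebra K (Fin 3) → FreeAlgebra K (Fin 3) → Prop
  | ra : D3Rel K α1 α2 (ι K (0 : Fin 3) * ι K (0 : Fin 3))
      (algebraMap K (FreeAlgebra K (Fin 3)) α1)
  | rb : D3Rel K α1 α2 (ι K (1 : Fin 3) * ι K (1 : Fin 3))
      (algebraMap K (FreeAlgebra K (Fin 3)) α1)
  | rc : D3Rel K α1 α2 (ι K (2 : Fin 3) * ι K (2 : Fin 3))
      (algebraMap K (FreeAlgebra K (Fin 3)) α1)
  | r1 : D3Rel K α1 α2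
      (ι K (2 : Fin 3) * ι K (0 : Fin 3) + ι K (1 : Fin 3) * ι K (2 : Fin 3) +
        ι K (0 : Fin 3) * ι K (1 : Fin 3))
      (algebraMap K (FreeAlgebra K (Fin 3)) α2)
  | r2 : D3Rel K α1 α2
      (ι K (2 : Fin 3) * ι K (1 : Fin 3) + ι K (1 : Fin 3) * ι K (0 : Fin 3) +
        ι K (0 : Fin 3) * ι K (2 : Fin 3))
      (algebraMap K (FreeAlgebra K (Fin 3)) α2)

/-- The algebra `D₃(α₁, α₂)`: the quotient of the free algebra `K⟨a,b,c⟩` by the two-sided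
ideal generated by the relations above. -/
abbrev D3 (K : Type) [Field K] (α1 α2 : K) : Type := RingQuot (D3Rel K α1 α2)

/-- The generator `a` of `D₃(α₁, α₂)`. -/
def D3a (K : Type) [Field K] (α1 α2 : K) : D3 K α1 α2 :=
  RingQuot.mkAlgHom K (D3Rel K α1 α2) (ι K (0 : Fin 3))

/-- The generator `b` of `D₃(α₁, α₂)`. -/
def D3b (K : Type) [Field K] (α1 α2 : K) : D3 K α1 α2 :=
  RingQuot.mkAlgHom K (D3Rel K α1 α2) (ι K (1 : Fin 3))

/-- The generator `c` of `D₃(α₁, α₂)`. -/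
def D3c (K : Type) [Field K] (α1 α2 : K) : D3 K α1 α2 :=
  RingQuot.mkAlgHom K (D3Rel K α1 α2) (ι K (2 : Fin 3))

theorem D3a_mul_self (K : Type) [Field K] (α1 α2 : K) :
    D3a K α1 α2 * D3a K α1 α2 = algebraMap K (D3 K α1 α2) α1 := by
  simpa [D3a] using RingQuot.mkAlgHom_rel K (D3Rel.ra (α1 := α1) (α2 := α2))

theorem D3b_mul_self (K : Type) [Field K] (α1 α2 : K) :
    D3b K α1 α2 * D3b K α1 α2 = algebraMap K (D3 K α1 α2) α1 := by
  simpa [D3b] using RingQuot.mkAlgHom_rel K (D3Rel.rb (α1 := α1) (α2 := α2))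

theorem D3c_mul_self (K : Type) [Field K] (α1 α2 : K) :
    D3c K α1 α2 * D3c K α1 α2 = algebraMap K (D3 K α1 α2) α1 := by
  simpa [D3c] using RingQuot.mkAlgHom_rel K (D3Rel.rc (α1 := α1) (α2 := α2))

theorem D3_ca_add_bc_add_ab (K : Type) [Field K] (α1 α2 : K) :
    D3c K α1 α2 * D3a K α1 α2 + D3b K α1 α2 * D3c K α1 α2 + D3a K α1 α2 * D3b K α1 α2 =
      algebraMap K (D3 K α1 α2) α2 := by
  simpa [D3a, D3b, D3c] using RingQuot.mkAlgHom_rel K (D3Rel.r1 (α1 := α1) (α2 := α2))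

theorem D3_cb_add_ba_add_ac (K : Type) [Field K] (α1 α2 : K) :
    D3c K α1 α2 * D3b K α1 α2 + D3b K α1 α2 * D3a K α1 α2 + D3a K α1 α2 * D3c K α1 α2 =
      algebraMap K (D3 K α1 α2) α2 := by
  simpa [D3a, D3b, D3c] using RingQuot.mkAlgHom_rel K (D3Rel.r2 (α1 := α1) (α2 := α2))

/-- The braid-type relation `aba - bab = t(a - b)`. -/
theorem mul_mul_sub_mul_mul_of_rels {R : Type*} [Ring R] {a b c s t : R} (ht : Commute b t)
    (ha : a * a = s) (hb : b * b = s) (hs : Commute c s)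
    (h : c * a + b * c + a * b = t) :
    a * b * a - b * a * b = t * (a - b) := by
  have e1 : a * b = t - c * a - b * c := by rw [← h]; abel
  have e2 : a * b * a = t * a - c * s - b * c * a := by
    rw [e1, ← ha]; noncomm_ring
  have e3 : b * a * b = b * t - b * c * a - s * c := by
    rw [mul_assoc, e1, ← hb]; noncomm_ring
  rw [e2, e3, hs.eq, ht.eq]
  noncomm_ring

/-- The commutation relations between the differences of three elements of a `K`-algebra which
satisfy the defining relations of `D₃(α₁, α₂)`. -/
theorem differences_rels_of_D3_rels {K A : Type*} [CommRing K] [Ring A] [Algebra K A]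
    {α1 α2 : K} {a b c : A}
    (ha : a * a = algebraMap K A α1) (hb : b * b = algebraMap K A α1)
    (hc : c * c = algebraMap K A α1)
    (h1 : c * a + b * c + a * b = algebraMap K A α2)
    (h2 : c * b + b * a + a * c = algebraMap K A α2) :
    let u := a - b
    let v := b - c
    let w := c - a
    u * a = -(b * u) ∧ u * b = -(a * u) ∧ u * c = (c - a - b) * u ∧
    u * v = v * u ∧ u * w = w * u ∧ v * w = w * v ∧
    u * v + v * w + u * w = algebraMap K A (α2 - 3 * α1) ∧
    u ^ 3 = (3 * α1 - α2) • u ∧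
    u ^ 2 * v + u * v ^ 2 = 0 ∧
    u * v * w = 0 := by
  intro u v w
  have hs (x : A) : Commute x (algebraMap K A α1) :=
    (Algebra.commutes α1 x).symm
  have ht (x : A) : Commute x (algebraMap K A α2) :=
    (Algebra.commutes α2 x).symm
  have hbraid := mul_mul_sub_mul_mul_of_rels (ht b) ha hb (hs c) h1
  have hscalar : algebraMap K A (α2 - 3 * α1) =
      algebraMap K A α2 - 3 * algebraMap K A α1 := by
    rw [map_sub, map_mul, map_ofNat]
  have hw : w = -u - v := by simp only [u, v, w]; abel
  have h12 := h1.trans h2.symm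
  have huv : u * v = v * u := by
    rw [← sub_eq_zero]
    calc u * v - v * u = (c * a + b * c + a * b) - (c * b + b * a + a * c) := by
          simp only [u, v]; noncomm_ring
      _ = 0 := sub_eq_zero.2 h12
  have hcomm : Commute u v := huv
  have huw : u * w = w * u := hw ▸ ((Commute.refl u).neg_right.sub_right hcomm).eq
  have hvw : v * w = w * v := hw ▸ (hcomm.symm.neg_right.sub_right (Commute.refl v)).eq
  have he : u * v + v * w + u * w = algebraMap K A (α2 - 3 * α1) := by
    calc u * v + v * w + u * w = (c * a + b * c + a * b) - a * a - b * b - c * c := by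
          simp only [u, v, w]; noncomm_ring
      _ = _ := by rw [h1, ha, hb, hc, hscalar]; noncomm_ring
  have hcube : u ^ 3 = -(algebraMap K A (α2 - 3 * α1) * u) := by
    calc u ^ 3 = a * (a * a) - (a * a) * b + b * b * a - b * (b * b) + a * (b * b) - b * (a * a)
            - (a * b * a - b * a * b) := by
          simp only [u]; noncomm_ring
      _ = _ := by
          rw [hbraid, ha, hb, (hs a).eq, (hs b).eq, hscalar]
          simp only [u]; noncomm_ring
  have huvw : u * v * w = 0 := by
    calc u * v * w = u * (u * v + v * w + u * w) + u ^ 3 := by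
          rw [hw]; noncomm_ring
      _ = 0 := by rw [he, hcube, ← Algebra.commutes]; abel
  refine ⟨?_, ?_, ?_, huv, huw, hvw, he, ?_, ?_, huvw⟩
  · simp only [u, sub_mul, mul_sub, ha, hb]; abel
  · simp only [u, sub_mul, mul_sub, ha, hb]; abel
  · rw [← sub_eq_zero]
    calc u * c - (c - a - b) * u = (c * b + b * a + a * c) - (c * a + b * c + a * b)
            + a * a - b * b := by simp only [u]; noncomm_ring
      _ = 0 := by rw [h1, h2, ha, hb]; abel
  · rw [hcube, Algebra.smul_def, ← neg_mul, ← map_neg, neg_sub]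
  · calc u ^ 2 * v + u * v ^ 2 = -(u * (w * v)) := by rw [hw]; noncomm_ring
      _ = 0 := by rw [← hvw, ← mul_assoc, huvw, neg_zero]

theorem D3_urels (K : Type) [Field K] [IsAlgClosed K] (hchar : ringChar K ≠ 2) (α1 α2 : K) :
    let a := D3a K α1 α2
    let b := D3b K α1 α2
    let c := D3c K α1 α2
    let u := a - b
    let v := b - c
    let w := c - a
    u * a = -(b * u) ∧ u * b = -(a * u) ∧ u * c = (c - a - b) * u ∧
    u * v = v * u ∧ u * w = w * u ∧ v * w = w * v ∧
    u * v + v * w + u * w = algebraMap K (D3 K α1 α2) (α2 - 3 * α1) ∧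
    u ^ 3 = (3 * α1 - α2) • u ∧
    u ^ 2 * v + u * v ^ 2 = 0 ∧
    u * v * w = 0 := by
  exact differences_rels_of_D3_rels (D3a_mul_self K α1 α2) (D3b_mul_self K α1 α2)
    (D3c_mul_self K α1 α2) (D3_ca_add_bc_add_ab K α1 α2) (D3_cb_add_ba_add_ac K α1 α2)
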